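/- Let d ∈ {2, 3} and 0 < b < d/2 < a. There is a constant C > 0, depending only on d, a, b, such that for all families (V̂_j)_{j ∈ ℤ^d₀} of vectors in ℂ^d and (f̂_j)_{j ∈ ℤ^d₀} of complex numbers (each extended by 0 at the index 0), one has ∑_{k ∈ ℤ^d₀} |2πk|^{−2b} (∑_{j ∈ ℤ^d₀} |V̂_j| |f̂_{k−j}|)² ≤ C ‖V‖²_{H^a} ‖f‖²_{H^{−b}}. (For a divergence-free vector field V, i.e. j·V̂_j = 0 for all j, the Fourier coefficient of V·∇f at k is 2πi ∑_j (V̂_j·k) f̂_{k−j}, which is bounded in modulus by 2π|k| ∑_j |V̂_j||f̂_{k−j}|; hence this inequality yields the transport estimate ‖V·∇f‖_{H^{−1−b}} ≲ ‖V‖_{H^a} ‖f‖_{H^{−b}}.) -/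

import Mathlib

open scoped ENNReal

/-- Euclidean norm of a lattice point `k ∈ ℤ^d`. -/
noncomputable def znorm {d : ℕ} (k : Fin d → ℤ) : ℝ :=
  Real.sqrt (∑ i, ((k i : ℝ)) ^ 2)

/-- The lattice point `k` as a vector of Euclidean space. -/
noncomputable def latticeVec {d : ℕ} (k : Fin d → ℤ) : EuclideanSpace ℝ (Fin d) :=
  WithLp.toLp 2 fun i => (k i : ℝ)

lemma norm_latticeVec {d : ℕ} (k : Fin d → ℤ) : ‖latticeVec k‖ = znorm k := by
  simp [latticeVec, znorm, EuclideanSpace.norm_eq]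

lemma latticeVec_injective {d : ℕ} : Function.Injective (latticeVec (d := d)) := by
  intro k l h
  ext i
  simpa [latticeVec] using congrArg (fun x : EuclideanSpace ℝ (Fin d) => x i) h

lemma latticeVec_sub {d : ℕ} (k l : Fin d → ℤ) :
    latticeVec (k - l) = latticeVec k - latticeVec l := by
  ext i
  simp [latticeVec]

lemma znorm_zero {d : ℕ} : znorm (0 : Fin d → ℤ) = 0 := by
  simp [znorm]

lemma znorm_pos {d : ℕ} {k : Fin d → ℤ} (hk : k ≠ 0) : 0 < znorm k := by
  have h : latticeVec k ≠ latticeVec 0 := latticeVec_injective.ne hk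
  rw [← norm_latticeVec]
  refine norm_pos_iff.2 fun h0 => h ?_
  rw [h0, ← norm_eq_zero.1 ((norm_latticeVec 0).trans znorm_zero)]

lemma znorm_sub_le {d : ℕ} (k l : Fin d → ℤ) : znorm (k - l) ≤ znorm k + znorm l := by
  simpa only [← norm_latticeVec, latticeVec_sub] using norm_sub_le (latticeVec k) (latticeVec l)

lemma summable_znorm_rpow {d : ℕ} {r : ℝ} (hr : r < -(d : ℝ)) :
    Summable fun k : Fin d → ℤ => znorm k ^ r := by
  let b := (EuclideanSpace.basisFun (Fin d) ℝ).toBasis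
  let L := Submodule.span ℤ (Set.range b)
  have hmem : ∀ k : Fin d → ℤ, latticeVec k ∈ L := by
    intro k
    have h : latticeVec k = ∑ i, k i • b i := by
      ext j
      simp [b, latticeVec, Finset.sum_apply, Pi.single_apply]
    rw [h]
    exact Submodule.sum_mem _ fun i _ =>
      Submodule.smul_mem _ _ (Submodule.subset_span (Set.mem_range_self i))
  have hrank : Module.finrank ℤ L = d := by
    rw [ZLattice.rank ℝ L]
    simp
  have hs := ZLattice.summable_norm_rpow L r (by rwa [hrank])
  have hinj : Function.Injective fun k : Fin d → ℤ => (⟨latticeVec k, hmem k⟩ : L) :=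
    fun k l h => latticeVec_injective (congrArg Subtype.val h)
  refine (hs.comp_injective hinj).congr fun k => ?_
  simp [← norm_latticeVec]

lemma rpow_neg_le_of_le_add {x y z a b : ℝ} (hx : 0 < x) (hy : 0 < y) (hz : 0 < z)
    (hzxy : z ≤ x + y) (hb : 0 ≤ b) (hba : b ≤ a) :
    x ^ (-b) ≤ 2 ^ b * (y ^ (-a) + x ^ (-a)) * (y ^ a * z ^ (-b)) := by
  have key : x ^ (-b) * z ^ b ≤ 2 ^ b * ((y ^ (-a) + x ^ (-a)) * y ^ a) := by
    rcases le_total y x with h | h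
    · have h1 : z ^ b ≤ 2 ^ b * x ^ b := by
        rw [← Real.mul_rpow two_pos.le hx.le]
        exact Real.rpow_le_rpow hz.le (by linarith) hb
      calc x ^ (-b) * z ^ b ≤ x ^ (-b) * (2 ^ b * x ^ b) := by gcongr
        _ = 2 ^ b * (y ^ (-a) * y ^ a) := by
          rw [← Real.rpow_add hy, mul_left_comm, ← Real.rpow_add hx]
          simp
        _ ≤ _ := by
          gcongr
          exact le_add_of_nonneg_right (by positivity)
    · have h1 : z ^ b ≤ 2 ^ b * y ^ b := by
        rw [← Real.mul_rpow two_pos.le hy.le]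
        exact Real.rpow_le_rpow hz.le (by linarith) hb
      calc x ^ (-b) * z ^ b ≤ x ^ (-b) * (2 ^ b * y ^ b) := by gcongr
        _ = 2 ^ b * (x ^ (-a) * (x ^ (a - b) * y ^ b)) := by
          rw [← mul_assoc (x ^ (-a)), ← Real.rpow_add hx]
          ring_nf
        _ ≤ 2 ^ b * (x ^ (-a) * (y ^ (a - b) * y ^ b)) := by
          have := Real.rpow_le_rpow hx.le h (sub_nonneg.2 hba)
          gcongr
        _ = 2 ^ b * (x ^ (-a) * y ^ a) := by
          rw [← Real.rpow_add hy]
          ring_nf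
        _ ≤ _ := by
          gcongr
          exact le_add_of_nonneg_left (by positivity)
  calc x ^ (-b) = x ^ (-b) * z ^ b * z ^ (-b) := by
        rw [mul_assoc, ← Real.rpow_add hz]
        simp
    _ ≤ 2 ^ b * ((y ^ (-a) + x ^ (-a)) * y ^ a) * z ^ (-b) := by gcongr
    _ = _ := by ring

namespace ENNReal

lemma sq_tsum_mul_le {ι : Type*} (u v : ι → ℝ≥0∞) :
    (∑' i, u i * v i) ^ 2 ≤ (∑' i, u i ^ 2) * ∑' i, v i ^ 2 := by
  let _ : MeasurableSpace ι := ⊤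
  have h := ENNReal.lintegral_mul_le_Lp_mul_Lq MeasureTheory.Measure.count
    Real.HolderConjugate.two_two (f := u) (g := v) measurable_from_top.aemeasurable
    measurable_from_top.aemeasurable
  simp only [MeasureTheory.lintegral_count, Pi.mul_apply, ENNReal.rpow_two] at h
  calc (∑' i, u i * v i) ^ 2
      ≤ ((∑' i, u i ^ 2) ^ (1 / 2 : ℝ) * (∑' i, v i ^ 2) ^ (1 / 2 : ℝ)) ^ 2 := by gcongr
    _ = _ := by
      rw [mul_pow, ← ENNReal.rpow_mul_natCast, ← ENNReal.rpow_mul_natCast]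
      simp

lemma add_sq_le_two_mul (x y : ℝ≥0∞) : (x + y) ^ 2 ≤ 2 * (x ^ 2 + y ^ 2) := by
  have h := ENNReal.rpow_add_le_mul_rpow_add_rpow x y (one_le_two : (1 : ℝ) ≤ 2)
  norm_num at h
  exact h

lemma tsum_sub_left {G : Type*} [AddCommGroup G] (v : G → ℝ≥0∞) (k : G) :
    ∑' j, v (k - j) = ∑' j, v j :=
  (Equiv.subLeft k).tsum_eq v

lemma tsum_sub_right {G : Type*} [AddCommGroup G] (v : G → ℝ≥0∞) (j : G) :
    ∑' k, v (k - j) = ∑' k, v k :=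
  (Equiv.subRight j).tsum_eq v

/-- Young's inequality `ℓ¹ * ℓ² ⊆ ℓ²`. -/
lemma tsum_sq_conv_le {G : Type*} [AddCommGroup G] (u v : G → ℝ≥0∞) :
    ∑' k, (∑' j, u j * v (k - j)) ^ 2 ≤ (∑' j, u j) ^ 2 * ∑' k, v k ^ 2 := by
  have hsqrt : ∀ x : ℝ≥0∞, (x ^ (1 / 2 : ℝ)) ^ 2 = x := fun x => by
    rw [← ENNReal.rpow_mul_natCast]
    simp
  have h : ∀ k, (∑' j, u j * v (k - j)) ^ 2 ≤ (∑' j, u j) * ∑' j, u j * v (k - j) ^ 2 := by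
    intro k
    have := sq_tsum_mul_le (fun j => u j ^ (1 / 2 : ℝ)) fun j => u j ^ (1 / 2 : ℝ) * v (k - j)
    simpa only [mul_pow, hsqrt, ← mul_assoc, ← sq] using this
  calc ∑' k, (∑' j, u j * v (k - j)) ^ 2
      ≤ ∑' k, (∑' j, u j) * ∑' j, u j * v (k - j) ^ 2 := ENNReal.tsum_le_tsum h
    _ = (∑' j, u j) * ∑' j, ∑' k, u j * v (k - j) ^ 2 := by
      rw [ENNReal.tsum_mul_left, ENNReal.tsum_comm]
    _ = _ := by
      simp only [ENNReal.tsum_mul_left, tsum_sub_right fun i => v i ^ 2, ENNReal.tsum_mul_right]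
      rw [sq, mul_assoc]

/-- A bilinear `ℓ²` bound for convolutions whose kernel is at most `p j + p k` with `p ∈ ℓ²`. -/
lemma tsum_sq_weighted_conv_le {G : Type*} [AddCommGroup G] (p u v : G → ℝ≥0∞) :
    ∑' k, (∑' j, (p j + p k) * (u j * v (k - j))) ^ 2 ≤
      4 * (∑' k, p k ^ 2) * (∑' k, u k ^ 2) * ∑' k, v k ^ 2 := by
  have h₁ : ∑' k, (∑' j, p j * u j * v (k - j)) ^ 2 ≤
      (∑' k, p k ^ 2) * (∑' k, u k ^ 2) * ∑' k, v k ^ 2 :=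
    (tsum_sq_conv_le _ _).trans (mul_le_mul_left (sq_tsum_mul_le p u) _)
  have h₂ : ∑' k, (p k * ∑' j, u j * v (k - j)) ^ 2 ≤
      (∑' k, p k ^ 2) * (∑' k, u k ^ 2) * ∑' k, v k ^ 2 := by
    rw [mul_assoc, ← ENNReal.tsum_mul_right]
    refine ENNReal.tsum_le_tsum fun k => ?_
    rw [mul_pow, ← tsum_sub_left (fun i => v i ^ 2) k]
    gcongr
    exact sq_tsum_mul_le u fun j => v (k - j)
  calc ∑' k, (∑' j, (p j + p k) * (u j * v (k - j))) ^ 2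
      = ∑' k, ((∑' j, p j * u j * v (k - j)) + p k * ∑' j, u j * v (k - j)) ^ 2 := by
        simp only [add_mul, ENNReal.tsum_add, ENNReal.tsum_mul_left, mul_assoc]
    _ ≤ ∑' k, 2 * ((∑' j, p j * u j * v (k - j)) ^ 2 + (p k * ∑' j, u j * v (k - j)) ^ 2) :=
        ENNReal.tsum_le_tsum fun k => add_sq_le_two_mul _ _
    _ ≤ 2 * ((∑' k, p k ^ 2) * (∑' k, u k ^ 2) * (∑' k, v k ^ 2) +
          (∑' k, p k ^ 2) * (∑' k, u k ^ 2) * ∑' k, v k ^ 2) := by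
        rw [ENNReal.tsum_mul_left, ENNReal.tsum_add]
        gcongr
    _ = _ := by ring

end ENNReal

/-- for `0 < b < d/2 < a`,
`∑_k |2πk|^{-2b} (∑_j |V̂_j| |f̂_{k-j}|)² ≲ ‖V‖²_{H^a} ‖f‖²_{H^{-b}}`
(Fourier-side form of the transport estimate `‖V·∇f‖_{H^{-1-b}} ≲ ‖V‖_{H^a}‖f‖_{H^{-b}}`). -/
theorem stmt3 {d : ℕ} (hd : d = 2 ∨ d = 3) (a b : ℝ)
    (hb : 0 < b) (hbd : b < d / 2) (ha : (d : ℝ) / 2 < a) :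
    ∃ C : ℝ, 0 < C ∧
      ∀ (V : (Fin d → ℤ) → EuclideanSpace ℂ (Fin d)) (f : (Fin d → ℤ) → ℂ),
        V 0 = 0 → f 0 = 0 →
        (∑' k : Fin d → ℤ,
            ENNReal.ofReal ((2 * Real.pi * znorm k) ^ (-(2 : ℝ) * b)) *
              (∑' j : Fin d → ℤ, (‖V j‖₊ : ℝ≥0∞) * (‖f (k - j)‖₊ : ℝ≥0∞)) ^ 2) ≤
          ENNReal.ofReal C *
            (∑' k : Fin d → ℤ,
              ENNReal.ofReal ((2 * Real.pi * znorm k) ^ (2 * a)) * (‖V k‖₊ : ℝ≥0∞) ^ 2) *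
            (∑' k : Fin d → ℤ,
              ENNReal.ofReal ((2 * Real.pi * znorm k) ^ (-(2 : ℝ) * b)) *
                (‖f k‖₊ : ℝ≥0∞) ^ 2) := by
  have hba : b ≤ a := by linarith
  set w : (Fin d → ℤ) → ℝ := fun k => 2 * Real.pi * znorm k with hw
  have hw0 : ∀ k, 0 ≤ w k := fun k => by
    simp only [hw, znorm]
    positivity
  have hwpos : ∀ k, k ≠ 0 → 0 < w k := fun k hk =>
    mul_pos Real.two_pi_pos (znorm_pos hk)
  have hsub : ∀ k j, w (k - j) ≤ w k + w j := fun k j => by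
    simp only [hw, ← mul_add]
    exact mul_le_mul_of_nonneg_left (znorm_sub_le k j) Real.two_pi_pos.le
  have hsq : ∀ (r : ℝ) k, ENNReal.ofReal (w k ^ r) ^ 2 = ENNReal.ofReal (w k ^ (2 * r)) := by
    intro r k
    rw [← ENNReal.ofReal_pow (Real.rpow_nonneg (hw0 k) r), ← Real.rpow_mul_natCast (hw0 k)]
    congr 2
    push_cast
    ring
  have hsum : Summable fun k => w k ^ (2 * -a) := by
    have h := (summable_znorm_rpow (d := d) (r := 2 * -a) (by linarith)).mul_left
      ((2 * Real.pi) ^ (2 * -a))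
    refine h.congr fun k => ?_
    exact (Real.mul_rpow Real.two_pi_pos.le (Real.sqrt_nonneg _)).symm
  have hS0 : 0 ≤ ∑' k, w k ^ (2 * -a) := tsum_nonneg fun k => Real.rpow_nonneg (hw0 k) _
  refine ⟨(2 ^ b) ^ 2 * (4 * (∑' k, w k ^ (2 * -a) + 1)), by positivity, fun V f hV hf => ?_⟩
  set c : ℝ≥0∞ := ENNReal.ofReal (2 ^ b) with hc
  set p : (Fin d → ℤ) → ℝ≥0∞ := fun k => ENNReal.ofReal (w k ^ (-a)) with hp
  set u : (Fin d → ℤ) → ℝ≥0∞ := fun k => ENNReal.ofReal (w k ^ a) * ‖V k‖₊ with hu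
  set v : (Fin d → ℤ) → ℝ≥0∞ := fun k => ENNReal.ofReal (w k ^ (-b)) * ‖f k‖₊ with hv
  have hC : c ^ 2 * (4 * ∑' k, p k ^ 2) ≤
      ENNReal.ofReal ((2 ^ b) ^ 2 * (4 * (∑' k, w k ^ (2 * -a) + 1))) := by
    have hpS : ∑' k, p k ^ 2 = ENNReal.ofReal (∑' k, w k ^ (2 * -a)) := by
      simp only [hp, hsq]
      exact (ENNReal.ofReal_tsum_of_nonneg (fun k => Real.rpow_nonneg (hw0 k) _) hsum).symm
    rw [hpS, ENNReal.ofReal_mul (by positivity), ENNReal.ofReal_mul (by norm_num),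
      ENNReal.ofReal_pow (by positivity), ENNReal.ofReal_ofNat]
    gcongr
    linarith
  have hker : ∀ k j, ENNReal.ofReal (w k ^ (-b)) * (‖V j‖₊ * ‖f (k - j)‖₊) ≤
      c * ((p j + p k) * (u j * v (k - j))) := by
    intro k j
    rcases eq_or_ne k 0 with rfl | hk
    · have : w 0 ^ (-b) = 0 := by
        simp [hw, znorm_zero, Real.zero_rpow (neg_ne_zero.2 hb.ne')]
      simp [this]
    rcases eq_or_ne j 0 with rfl | hj
    · simp [hV]
    rcases eq_or_ne (k - j) 0 with hl | hl
    · simp [hl, hf]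
    have h := ENNReal.ofReal_le_ofReal <| rpow_neg_le_of_le_add (hwpos k hk) (hwpos j hj)
      (hwpos _ hl) (hsub k j) hb.le hba
    have e₁ := Real.rpow_nonneg (hw0 j) (-a)
    have e₂ := Real.rpow_nonneg (hw0 k) (-a)
    have e₃ := Real.rpow_nonneg (hw0 j) a
    rw [ENNReal.ofReal_mul (by positivity), ENNReal.ofReal_mul (by positivity),
      ENNReal.ofReal_add e₁ e₂, ENNReal.ofReal_mul e₃] at h
    refine (mul_le_mul_left h _).trans_eq ?_
    simp only [hp, hu, hv, hc]
    ring
  calc ∑' k, ENNReal.ofReal (w k ^ (-(2 : ℝ) * b)) *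
        (∑' j, (‖V j‖₊ : ℝ≥0∞) * (‖f (k - j)‖₊ : ℝ≥0∞)) ^ 2
      = ∑' k, (∑' j, ENNReal.ofReal (w k ^ (-b)) * (‖V j‖₊ * ‖f (k - j)‖₊)) ^ 2 := by
        refine tsum_congr fun k => ?_
        rw [ENNReal.tsum_mul_left, mul_pow, hsq, mul_neg, neg_mul]
    _ ≤ ∑' k, (∑' j, c * ((p j + p k) * (u j * v (k - j)))) ^ 2 :=
        ENNReal.tsum_le_tsum fun k => by
          gcongr ?_ ^ 2
          exact ENNReal.tsum_le_tsum fun j => hker k j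
    _ = c ^ 2 * ∑' k, (∑' j, (p j + p k) * (u j * v (k - j))) ^ 2 := by
        simp only [ENNReal.tsum_mul_left, mul_pow]
    _ ≤ c ^ 2 * (4 * (∑' k, p k ^ 2) * (∑' k, u k ^ 2) * ∑' k, v k ^ 2) := by
        gcongr
        exact ENNReal.tsum_sq_weighted_conv_le p u v
    _ = c ^ 2 * (4 * ∑' k, p k ^ 2) * (∑' k, u k ^ 2) * ∑' k, v k ^ 2 := by ring
    _ ≤ _ := by
        refine (mul_le_mul_left (mul_le_mul_left hC _) _).trans_eq ?_
        simp only [hu, hv, mul_pow, hsq, mul_neg, neg_mul]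
        rfl
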